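/- arXiv:2110.01030 — 2 statements merged into one kernel-verified Lean document; each statement's English description precedes it below -/
import Mathlib

section
/- Let G be an SSG, σ a MAX strategy and τ(σ) a best response to σ. Then σ is optimal if and only if v_σ satisfies the local optimality condition: for every x ∈ V_MAX, v_σ(x) = max{v_σ(y) : (x,y) ∈ E}, and for every x ∈ V_MIN, v_σ(x) = min{v_σ(y) : (x,y) ∈ E}. -/
open scoped BigOperators

instance : Fact ((0:ℝ) ≤ 1) := ⟨zero_le_one⟩

/-- A simple stochastic game on a finite vertex set `V`. -/
structure SSG (V : Type*) [Fintype V] [DecidableEq V] where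
  /-- MAX vertices -/
  VMax : Finset V
  /-- MIN vertices -/
  VMin : Finset V
  /-- random vertices -/
  VR : Finset V
  /-- sink vertices -/
  VS : Finset V
  cover : ∀ x : V, x ∈ VMax ∨ x ∈ VMin ∨ x ∈ VR ∨ x ∈ VS
  disjMaxMin : Disjoint VMax VMin
  disjMaxR : Disjoint VMax VR
  disjMaxS : Disjoint VMax VS
  disjMinR : Disjoint VMin VR
  disjMinS : Disjoint VMin VS
  disjRS : Disjoint VR VS
  /-- out-neighbourhood: `y ∈ succ x` iff `(x,y)` is an edge -/
  succ : V → Finset V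
  outMax : ∀ x ∈ VMax, 2 ≤ (succ x).card
  outMin : ∀ x ∈ VMin, 2 ≤ (succ x).card
  outR : ∀ x ∈ VR, 1 ≤ (succ x).card
  /-- transition probabilities at random vertices -/
  prob : V → V → ℝ
  prob_nonneg : ∀ x y, 0 ≤ prob x y
  prob_support : ∀ x ∈ VR, ∀ y, y ∉ succ x → prob x y = 0
  prob_sum : ∀ x ∈ VR, (∑ y, prob x y) = 1
  /-- values of the sinks -/
  val : V → ℝ
  val_mem : ∀ x ∈ VS, val x ∈ Set.Icc (0:ℝ) 1

namespace SSG

variable {V : Type*} [Fintype V] [DecidableEq V]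

/-- A positional MAX strategy: a choice of an out-neighbour at every MAX vertex
(normalised to the identity away from `VMax`). -/
structure MaxStrategy (G : SSG V) where
  toFun : V → V
  mem_succ : ∀ x ∈ G.VMax, toFun x ∈ G.succ x
  eq_id : ∀ x ∉ G.VMax, toFun x = x

/-- A positional MIN strategy. -/
structure MinStrategy (G : SSG V) where
  toFun : V → V
  mem_succ : ∀ x ∈ G.VMin, toFun x ∈ G.succ x
  eq_id : ∀ x ∉ G.VMin, toFun x = x

/-- The one-step (monotone) operator on value vectors associated with `(σ,τ)`. -/
noncomputable def F (G : SSG V) (σ : G.MaxStrategy) (τ : G.MinStrategy)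
    (w : V → unitInterval) (x : V) : unitInterval :=
  if _hM : x ∈ G.VMax then w (σ.toFun x)
  else if _hN : x ∈ G.VMin then w (τ.toFun x)
  else if hR : x ∈ G.VR then
    ⟨∑ y, G.prob x y * (w y : ℝ), by
      constructor
      · exact Finset.sum_nonneg fun y _ =>
          mul_nonneg (G.prob_nonneg x y) (w y).2.1
      · calc (∑ y, G.prob x y * (w y : ℝ)) ≤ ∑ y, G.prob x y :=
              Finset.sum_le_sum fun y _ =>
                mul_le_of_le_one_right (G.prob_nonneg x y) (w y).2.2
          _ = 1 := G.prob_sum x hR⟩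
  else ⟨G.val x, G.val_mem x (by
    rcases G.cover x with h | h | h | h
    · exact absurd h _hM
    · exact absurd h _hN
    · exact absurd h hR
    · exact h)⟩

/-- The value vector `v_{σ,τ}`: the least fixed point (à la Knaster–Tarski) of `F`. -/
noncomputable def value (G : SSG V) (σ : G.MaxStrategy) (τ : G.MinStrategy) :
    V → unitInterval :=
  sInf {w : V → unitInterval | G.F σ τ w ≤ w}

/-- `τ` is a best response to `σ`. -/
def IsBestResponse (G : SSG V) (σ : G.MaxStrategy) (τ : G.MinStrategy) : Prop :=
  ∀ τ' : G.MinStrategy, G.value σ τ ≤ G.value σ τ'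

/-- `σ` is an optimal MAX strategy: `v_σ ≥ v_{σ'}` for every MAX strategy `σ'`
(values being computed against best responses). -/
def IsOptimal (G : SSG V) (σ : G.MaxStrategy) : Prop :=
  ∀ τ : G.MinStrategy, G.IsBestResponse σ τ →
    ∀ σ' : G.MaxStrategy, ∀ τ' : G.MinStrategy, G.IsBestResponse σ' τ' →
      G.value σ' τ' ≤ G.value σ τ

/-- The switch set `S_σ` of `σ`, computed with a best response `τ` to `σ`. -/
def switchSet (G : SSG V) (σ : G.MaxStrategy) (τ : G.MinStrategy) : Set V :=
  {x | x ∈ G.VMax ∧ ∃ y ∈ G.succ x, G.value σ τ x < G.value σ τ y}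

/-- `σ'` is a `σ`-switch (w.r.t. a best response `τ` to `σ`). -/
def IsSwitch (G : SSG V) (σ : G.MaxStrategy) (τ : G.MinStrategy)
    (σ' : G.MaxStrategy) : Prop :=
  σ' ≠ σ ∧
  (∀ x ∈ G.VMax, x ∉ G.switchSet σ τ → σ'.toFun x = σ.toFun x) ∧
  (∀ x ∈ G.switchSet σ τ, σ'.toFun x ≠ σ.toFun x →
    G.value σ τ x < G.value σ τ (σ'.toFun x))

/-- `σ` agrees with `σ₀` on `T`. -/
def AgreesOn (G : SSG V) (T : Set V) (σ₀ σ : G.MaxStrategy) : Prop :=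
  ∀ x ∈ T, σ.toFun x = σ₀.toFun x

/-- `σ` is an optimal MAX strategy of the subgame `G_{|T[σ₀]}`: it agrees with `σ₀` on `T`
and its value vector dominates that of every MAX strategy of `G` agreeing with `σ₀` on `T`. -/
def IsOptimalOn (G : SSG V) (T : Set V) (σ₀ σ : G.MaxStrategy) : Prop :=
  G.AgreesOn T σ₀ σ ∧
  ∀ σ' : G.MaxStrategy, G.AgreesOn T σ₀ σ' →
    ∀ τ τ' : G.MinStrategy, G.IsBestResponse σ τ → G.IsBestResponse σ' τ' →
      G.value σ' τ' ≤ G.value σ τ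

/-- `σ'` is a `(σ,T)`-super-switch (w.r.t. a best response `τ` to `σ`): it is obtained from an
intermediate `σ`-switch `σ''` that only switches inside `T`, by taking an optimal strategy of
the subgame `G_{|T[σ'']}`. -/
def IsSuperSwitch (G : SSG V) (σ : G.MaxStrategy) (τ : G.MinStrategy)
    (T : Set V) (σ' : G.MaxStrategy) : Prop :=
  ∃ σ'' : G.MaxStrategy, G.IsSwitch σ τ σ'' ∧
    (∀ x ∈ G.VMax, x ∉ T → σ''.toFun x = σ.toFun x) ∧
    G.IsOptimalOn T σ'' σ'

/-- A binary SSG: every MAX vertex has outdegree exactly 2. -/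
def Binary (G : SSG V) : Prop := ∀ x ∈ G.VMax, (G.succ x).card = 2

/-- `σb` is the total switch `σ̄` of `σ` (in a binary SSG): it switches to the other
out-neighbour exactly on the switch set of `σ`. -/
def IsTotalSwitch (G : SSG V) (σ : G.MaxStrategy) (τ : G.MinStrategy)
    (σb : G.MaxStrategy) : Prop :=
  (∀ x ∈ G.switchSet σ τ, σb.toFun x ≠ σ.toFun x) ∧
  (∀ x ∈ G.VMax, x ∉ G.switchSet σ τ → σb.toFun x = σ.toFun x)

end SSG

namespace SSG

section Aux

variable {V : Type*} [Fintype V] [DecidableEq V] (G : SSG V)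

lemma F_max (σ : G.MaxStrategy) (τ : G.MinStrategy) (w : V → unitInterval) {x : V}
    (hx : x ∈ G.VMax) : G.F σ τ w x = w (σ.toFun x) := by
  simp [F, hx]

lemma F_min (σ : G.MaxStrategy) (τ : G.MinStrategy) (w : V → unitInterval) {x : V}
    (hx : x ∈ G.VMin) : G.F σ τ w x = w (τ.toFun x) := by
  have h1 : x ∉ G.VMax := fun h => Finset.disjoint_left.1 G.disjMaxMin h hx
  simp [F, hx, h1]

lemma F_rand (σ : G.MaxStrategy) (τ : G.MinStrategy) (w : V → unitInterval) {x : V}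
    (hx : x ∈ G.VR) : (G.F σ τ w x : ℝ) = ∑ y, G.prob x y * (w y : ℝ) := by
  have h1 : x ∉ G.VMax := fun h => Finset.disjoint_left.1 G.disjMaxR h hx
  have h2 : x ∉ G.VMin := fun h => Finset.disjoint_left.1 G.disjMinR h hx
  simp [F, hx, h1, h2]

lemma F_sink (σ : G.MaxStrategy) (τ : G.MinStrategy) (w : V → unitInterval) {x : V}
    (hx : x ∈ G.VS) : (G.F σ τ w x : ℝ) = G.val x := by
  have h1 : x ∉ G.VMax := fun h => Finset.disjoint_left.1 G.disjMaxS h hx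
  have h2 : x ∉ G.VMin := fun h => Finset.disjoint_left.1 G.disjMinS h hx
  have h3 : x ∉ G.VR := fun h => Finset.disjoint_left.1 G.disjRS h hx
  simp [F, h1, h2, h3]

/-- Away from MAX and MIN vertices, `F` does not depend on strategies and is monotone. -/
lemma F_le_other (σ σ' : G.MaxStrategy) (τ τ' : G.MinStrategy) {w w' : V → unitInterval}
    (h : w ≤ w') {x : V} (hx : x ∈ G.VR ∨ x ∈ G.VS) : G.F σ τ w x ≤ G.F σ' τ' w' x := by
  rw [← Subtype.coe_le_coe]
  rcases hx with hx | hx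
  · rw [F_rand _ _ _ _ hx, F_rand _ _ _ _ hx]
    exact Finset.sum_le_sum fun y _ => mul_le_mul_of_nonneg_left (h y) (G.prob_nonneg x y)
  · rw [F_sink _ _ _ _ hx, F_sink _ _ _ _ hx]

lemma F_mono (σ : G.MaxStrategy) (τ : G.MinStrategy) : Monotone (G.F σ τ) := by
  intro w w' h x
  rcases G.cover x with hx | hx | hx
  · rw [F_max _ _ _ _ hx, F_max _ _ _ _ hx]; exact h _
  · rw [F_min _ _ _ _ hx, F_min _ _ _ _ hx]; exact h _
  · exact G.F_le_other _ _ _ _ h hx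

lemma value_le (σ : G.MaxStrategy) (τ : G.MinStrategy) {w : V → unitInterval}
    (h : G.F σ τ w ≤ w) : G.value σ τ ≤ w := sInf_le h

lemma F_value (σ : G.MaxStrategy) (τ : G.MinStrategy) :
    G.F σ τ (G.value σ τ) = G.value σ τ := by
  have h1 : G.F σ τ (G.value σ τ) ≤ G.value σ τ :=
    le_sInf fun w hw => (G.F_mono σ τ (sInf_le hw)).trans hw
  exact le_antisymm h1 (G.value_le σ τ (G.F_mono σ τ h1))

lemma value_max (σ : G.MaxStrategy) (τ : G.MinStrategy) {x : V} (hx : x ∈ G.VMax) :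
    G.value σ τ x = G.value σ τ (σ.toFun x) := by
  rw [← G.F_max σ τ (G.value σ τ) hx, F_value]

lemma value_min (σ : G.MaxStrategy) (τ : G.MinStrategy) {x : V} (hx : x ∈ G.VMin) :
    G.value σ τ x = G.value σ τ (τ.toFun x) := by
  rw [← G.F_min σ τ (G.value σ τ) hx, F_value]

lemma value_rand (σ : G.MaxStrategy) (τ : G.MinStrategy) {x : V} (hx : x ∈ G.VR) :
    (G.value σ τ x : ℝ) = ∑ y, G.prob x y * (G.value σ τ y : ℝ) := by
  rw [← G.F_rand σ τ _ hx, F_value]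

lemma value_sink (σ : G.MaxStrategy) (τ : G.MinStrategy) {x : V} (hx : x ∈ G.VS) :
    (G.value σ τ x : ℝ) = G.val x := by
  rw [← G.F_sink σ τ (G.value σ τ) hx, F_value]

/-- The value vanishes on a closed set without sinks. -/
lemma value_zero_of_closed (σ : G.MaxStrategy) (τ : G.MinStrategy) (D : Set V)
    (hM : ∀ x ∈ D, x ∈ G.VMax → σ.toFun x ∈ D)
    (hN : ∀ x ∈ D, x ∈ G.VMin → τ.toFun x ∈ D)
    (hR : ∀ x ∈ D, x ∈ G.VR → ∀ y, G.prob x y = 0 ∨ y ∈ D)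
    (hS : ∀ x ∈ D, x ∉ G.VS) : ∀ x ∈ D, G.value σ τ x = 0 := by
  classical
  let u : V → unitInterval := fun x => if x ∈ D then 0 else G.value σ τ x
  have hu : u ≤ G.value σ τ := by
    intro x
    by_cases hx : x ∈ D
    · simp [u, hx]
    · simp [u, hx]
  have hF : G.F σ τ u ≤ u := by
    intro x
    by_cases hx : x ∈ D
    · have : G.F σ τ u x = 0 := by
        rcases G.cover x with h | h | h | h
        · rw [F_max _ _ _ _ h]; simp [u, hM x hx h]
        · rw [F_min _ _ _ _ h]; simp [u, hN x hx h]
        · apply Subtype.ext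
          rw [F_rand _ _ _ _ h]
          refine Finset.sum_eq_zero fun y _ => ?_
          rcases hR x hx h y with h0 | h0
          · simp [h0]
          · simp [u, h0]
        · exact absurd h (hS x hx)
      simp [u, hx, this]
    · have h1 := G.F_mono σ τ hu x
      rw [F_value] at h1
      simpa [u, hx] using h1
  intro x hx
  have h2 := G.value_le σ τ hF x
  simp only [u, hx, if_true] at h2
  exact le_antisymm h2 bot_le

instance finite_minStrategy : Finite G.MinStrategy :=
  Finite.of_injective (fun τ : G.MinStrategy => τ.toFun) (by
    rintro ⟨a, _, _⟩ ⟨b, _, _⟩ h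
    simpa using h)

lemma exists_bestResponse (σ : G.MaxStrategy) (τ₀ : G.MinStrategy) :
    ∃ τ, G.IsBestResponse σ τ := by
  classical
  have hd : Directed (· ≥ ·) (G.value σ) := by
    intro τ₁ τ₂
    let τ₃ : G.MinStrategy :=
      { toFun := fun x => if G.value σ τ₁ x ≤ G.value σ τ₂ x then τ₁.toFun x else τ₂.toFun x
        mem_succ := fun x hx => by
          split_ifs
          · exact τ₁.mem_succ x hx
          · exact τ₂.mem_succ x hx
        eq_id := fun x hx => by
          simp [τ₁.eq_id x hx, τ₂.eq_id x hx] }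
    have h3 : G.value σ τ₃ ≤ G.value σ τ₁ ⊓ G.value σ τ₂ := by
      apply value_le
      intro x
      rcases G.cover x with h | h | h
      · rw [F_max _ _ _ _ h, Pi.inf_apply, Pi.inf_apply, G.value_max σ τ₁ h,
          G.value_max σ τ₂ h]
      · rw [F_min _ _ _ _ h, Pi.inf_apply, Pi.inf_apply]
        by_cases hle : G.value σ τ₁ x ≤ G.value σ τ₂ x
        · have e : τ₃.toFun x = τ₁.toFun x := by simp [τ₃, hle]
          rw [e, inf_eq_left.2 hle, G.value_min σ τ₁ h]
          exact inf_le_left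
        · have e : τ₃.toFun x = τ₂.toFun x := by simp [τ₃, hle]
          rw [e, inf_eq_right.2 (le_of_not_ge hle), G.value_min σ τ₂ h]
          exact inf_le_right
      · refine le_inf ?_ ?_
        · have := G.F_le_other σ σ τ₃ τ₁
            (inf_le_left : G.value σ τ₁ ⊓ G.value σ τ₂ ≤ G.value σ τ₁) h
          rwa [F_value] at this
        · have := G.F_le_other σ σ τ₃ τ₂
            (inf_le_right : G.value σ τ₁ ⊓ G.value σ τ₂ ≤ G.value σ τ₂) h
          rwa [F_value] at this
    exact ⟨τ₃, h3.trans inf_le_left, h3.trans inf_le_right⟩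
  have : Nonempty G.MinStrategy := ⟨τ₀⟩
  obtain ⟨z, hz⟩ := hd.finite_le id
  exact ⟨z, hz⟩

/-- Strictly improving switches do not decrease the value. -/
lemma value_le_switch (σ σ' : G.MaxStrategy) (τ τ' : G.MinStrategy)
    (hbr : G.value σ τ ≤ G.value σ τ')
    (hmin : ∀ x ∈ G.VMin, ∀ y ∈ G.succ x, G.value σ τ x ≤ G.value σ τ y)
    (hsw : ∀ x ∈ G.VMax, σ'.toFun x = σ.toFun x ∨
      G.value σ τ x < G.value σ τ (σ'.toFun x)) :
    G.value σ τ ≤ G.value σ' τ' := by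
  intro x₀
  have : Nonempty V := ⟨x₀⟩
  let d : V → ℝ := fun x => (G.value σ τ x : ℝ) - G.value σ' τ' x
  obtain ⟨z, hz⟩ := Finite.exists_max d
  by_contra hcon
  have hpos : 0 < d z := by
    refine lt_of_lt_of_le ?_ (hz x₀)
    have : G.value σ' τ' x₀ < G.value σ τ x₀ := not_le.1 hcon
    exact sub_pos.2 this
  let D : Set V := {x | d x = d z}
  have hsame : ∀ x ∈ D, x ∈ G.VMax → σ'.toFun x = σ.toFun x ∧ σ'.toFun x ∈ D := by
    intro x hx hxM
    have e' := congrArg Subtype.val (G.value_max σ' τ' hxM)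
    have hxz : d x = d z := hx
    have hb := hz (σ'.toFun x)
    rcases hsw x hxM with h | h
    · refine ⟨h, ?_⟩
      have e := congrArg Subtype.val (G.value_max σ τ hxM)
      rw [← h] at e
      change d _ = d z
      rw [← hxz]
      simp only [d]
      rw [e, e']
    · exfalso
      have h' : (G.value σ τ x : ℝ) < G.value σ τ (σ'.toFun x) := h
      simp only [d] at hxz hb
      linarith
  have hzero := G.value_zero_of_closed σ τ' D
    (fun x hx hxM => by
      obtain ⟨h1, h2⟩ := hsame x hx hxM
      rwa [← h1])
    (fun x hx hxN => by
      have e' := congrArg Subtype.val (G.value_min σ' τ' hxN)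
      have hxz : d x = d z := hx
      have hb := hz (τ'.toFun x)
      have h' : (G.value σ τ x : ℝ) ≤ G.value σ τ (τ'.toFun x) :=
        hmin x hxN _ (τ'.mem_succ x hxN)
      change d _ = d z
      apply le_antisymm hb
      simp only [d] at hxz hb ⊢
      linarith)
    (fun x hx hxR y => by
      have e := G.value_rand σ τ hxR
      have e' := G.value_rand σ' τ' hxR
      have hxz : d x = d z := hx
      have hs : ∑ y, G.prob x y * (d z - d y) = 0 := by
        have h1 : ∑ y, G.prob x y * d y = d x := by
          simp only [d, mul_sub, Finset.sum_sub_distrib]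
          rw [← e, ← e']
        simp only [mul_sub]
        rw [Finset.sum_sub_distrib, h1, ← Finset.sum_mul, G.prob_sum x hxR, hxz]
        ring
      have h0 := (Finset.sum_eq_zero_iff_of_nonneg (fun y _ =>
        mul_nonneg (G.prob_nonneg x y) (sub_nonneg.2 (hz y)))).1 hs y (Finset.mem_univ y)
      rcases mul_eq_zero.1 h0 with h | h
      · exact Or.inl h
      · exact Or.inr (sub_eq_zero.1 h).symm)
    (fun x hx hxS => by
      have e := G.value_sink σ τ hxS
      have e' := G.value_sink σ' τ' hxS
      have hxz : d x = d z := hx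
      simp only [d] at hxz hpos
      linarith)
  have h1 : (G.value σ τ z : ℝ) ≤ G.value σ τ' z := hbr z
  have h2 : (G.value σ τ' z : ℝ) = 0 := congrArg Subtype.val (hzero z rfl)
  have h3 : (0 : ℝ) ≤ G.value σ' τ' z := (G.value σ' τ' z).2.1
  simp only [d] at hpos
  linarith

/-- A best response is locally optimal at MIN vertices. -/
lemma min_local (σ : G.MaxStrategy) (τ : G.MinStrategy) (hbr : G.IsBestResponse σ τ) :
    ∀ x ∈ G.VMin, ∀ y ∈ G.succ x, G.value σ τ x ≤ G.value σ τ y := by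
  intro x hx y hy
  by_contra hcon
  have hlt := not_le.1 hcon
  let τ' : G.MinStrategy :=
    { toFun := Function.update τ.toFun x y
      mem_succ := fun z hz => by
        by_cases h : z = x
        · subst h; simpa using hy
        · simpa [h] using τ.mem_succ z hz
      eq_id := fun z hz => by
        have h : z ≠ x := fun h => hz (h ▸ hx)
        simpa [h] using τ.eq_id z hz }
  have hτx : τ'.toFun x = y := by simp [τ']
  have hle : G.value σ τ' ≤ G.value σ τ := by
    apply value_le
    intro z
    rcases G.cover z with h | h | h
    · rw [F_max _ _ _ _ h, ← G.value_max σ τ h]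
    · rw [F_min _ _ _ _ h]
      by_cases hzx : z = x
      · subst hzx; rw [hτx]; exact hlt.le
      · have : τ'.toFun z = τ.toFun z := by simp [τ', hzx]
        rw [this, ← G.value_min σ τ h]
    · have := G.F_le_other σ σ τ' τ (le_refl (G.value σ τ)) h
      rwa [F_value] at this
  have h1 := hbr τ' x
  rw [G.value_min σ τ' hx, hτx] at h1
  exact absurd (h1.trans (hle y)) hcon

end Aux

end SSG

/-- `σ` is optimal iff `v_σ` satisfies the local optimality condition:
at each MAX vertex `v_σ(x)` is the maximum of `v_σ` over the out-neighbours of `x`,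
and at each MIN vertex it is the minimum. -/
theorem optimal_iff_locally_optimal {V : Type*} [Fintype V] [DecidableEq V] (G : SSG V)
    (σ : G.MaxStrategy) (τ : G.MinStrategy) (hbr : G.IsBestResponse σ τ) :
    G.IsOptimal σ ↔
      ((∀ x ∈ G.VMax,
          IsGreatest ((fun y => G.value σ τ y) '' (G.succ x : Set V)) (G.value σ τ x)) ∧
       (∀ x ∈ G.VMin,
          IsLeast ((fun y => G.value σ τ y) '' (G.succ x : Set V)) (G.value σ τ x))) := by
  have hmin := G.min_local σ τ hbr
  constructor
  · intro hopt
    refine ⟨fun x hx => ⟨⟨σ.toFun x, σ.mem_succ x hx, (G.value_max σ τ hx).symm⟩, ?_⟩,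
      fun x hx => ⟨⟨τ.toFun x, τ.mem_succ x hx, (G.value_min σ τ hx).symm⟩, ?_⟩⟩
    · rintro _ ⟨y, hy, rfl⟩
      by_contra hcon
      have hlt : G.value σ τ x < G.value σ τ y := not_le.1 hcon
      let σ' : G.MaxStrategy :=
        { toFun := Function.update σ.toFun x y
          mem_succ := fun z hz => by
            by_cases h : z = x
            · subst h; simpa using hy
            · simpa [h] using σ.mem_succ z hz
          eq_id := fun z hz => by
            have h : z ≠ x := fun h => hz (h ▸ hx)
            simpa [h] using σ.eq_id z hz }
      have hσx : σ'.toFun x = y := by simp [σ']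
      obtain ⟨τ', hτ'⟩ := G.exists_bestResponse σ' τ
      have h1 := G.value_le_switch σ σ' τ τ' (hbr τ') hmin (fun z hz => by
        by_cases h : z = x
        · subst h; right; rw [hσx]; exact hlt
        · left; simp [σ', h])
      have h2 := hopt τ hbr σ' τ' hτ' x
      rw [G.value_max σ' τ' hx, hσx] at h2
      exact hcon ((h1 y).trans h2)
    · rintro _ ⟨y, hy, rfl⟩
      exact hmin x hx y hy
  · rintro ⟨hM, -⟩ τ₁ hτ₁ σ' τ' hτ'
    refine (hτ' τ).trans (le_trans ?_ (hbr τ₁))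
    apply SSG.value_le
    intro z
    rcases G.cover z with h | h | h
    · rw [SSG.F_max _ _ _ _ h]
      exact (hM z h).2 ⟨σ'.toFun z, σ'.mem_succ z h, rfl⟩
    · rw [SSG.F_min _ _ _ _ h, ← G.value_min σ τ h]
    · have := G.F_le_other σ' σ τ τ (le_refl (G.value σ τ)) h
      rwa [SSG.F_value] at this
end

section
/- Let G be an SSG and x ∈ V_MAX. If σ and σ' are MAX strategies whose switch sets both equal the singleton {x} and which make the same choice at x (σ(x) = σ'(x)), then v_σ = v_{σ'}. -/
open scoped BigOperators

namespace SSG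

theorem F_mono_aux {V : Type*} [Fintype V] [DecidableEq V] (G : SSG V)
    (σ : G.MaxStrategy) (τ : G.MinStrategy) {w w' : V → unitInterval} (h : w ≤ w') :
    G.F σ τ w ≤ G.F σ τ w' := by
  intro y
  unfold F
  split_ifs
  · exact h _
  · exact h _
  · refine Subtype.mk_le_mk.2 (Finset.sum_le_sum fun z _ => ?_)
    exact mul_le_mul_of_nonneg_left (h z) (G.prob_nonneg y z)
  · exact le_rfl

theorem F_value_le_aux {V : Type*} [Fintype V] [DecidableEq V] (G : SSG V)
    (σ : G.MaxStrategy) (τ : G.MinStrategy) :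
    G.F σ τ (G.value σ τ) ≤ G.value σ τ := by
  refine le_sInf fun w hw => ?_
  exact (G.F_mono_aux σ τ (sInf_le hw)).trans hw

theorem value_le_aux {V : Type*} [Fintype V] [DecidableEq V] (G : SSG V)
    (x : V) (σ σ' : G.MaxStrategy) (τ τ' : G.MinStrategy)
    (hbr' : G.IsBestResponse σ' τ')
    (h1 : G.switchSet σ τ = {x})
    (hxx : σ.toFun x = σ'.toFun x) :
    G.value σ' τ' ≤ G.value σ τ := by
  refine (hbr' τ).trans (sInf_le ?_)
  intro y
  have hp := G.F_value_le_aux σ τ y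
  by_cases hy : y ∈ G.VMax
  · by_cases hyx : y = x
    · subst hyx
      simp only [F, hy, dif_pos] at hp ⊢
      rw [← hxx]
      exact hp
    · have hn : y ∉ G.switchSet σ τ := by
        rw [h1]
        exact hyx
      simp only [F, hy, dif_pos]
      by_contra hc
      exact hn ⟨hy, _, σ'.mem_succ y hy, not_le.1 hc⟩
  · simp only [F, hy, dif_neg, not_false_eq_true] at hp ⊢
    exact hp

end SSG

/-- two MAX strategies whose switch sets both equal `{x}` and which make the
same choice at `x` have the same value vector. -/
theorem value_eq_of_singleton_switchSet {V : Type*} [Fintype V] [DecidableEq V] (G : SSG V)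
    (x : V) (hx : x ∈ G.VMax) (σ σ' : G.MaxStrategy) (τ τ' : G.MinStrategy)
    (hbr : G.IsBestResponse σ τ) (hbr' : G.IsBestResponse σ' τ')
    (h1 : G.switchSet σ τ = {x}) (h2 : G.switchSet σ' τ' = {x})
    (hxx : σ.toFun x = σ'.toFun x) :
    G.value σ τ = G.value σ' τ' := by
  exact le_antisymm (G.value_le_aux x σ' σ τ' τ hbr h2 hxx.symm)
    (G.value_le_aux x σ σ' τ τ' hbr' h1 hxx)
end
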